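/- Let T be a tree on n ≥ 3 vertices, E its edge set, and f = {i,j} a non-edge of T with d(i,j) = d > 1. Then the characteristic polynomial of the n×n matrix Min4PC_T[B,B] with B = E ∪ {f} factors as (x+2)^{n−3} · g(x), where g(x) = x³ − (2n−6)x² − (nd² − 5d² + 2nd − 2d + 5n − 9)x − 2(d−1)²(n−1); equivalently, the eigenvalues of Min4PC_T[B,B] are −2 with multiplicity n−3 together with the three roots of g. -/

import Mathlib

open Polynomial

/-- The Min4PC value of two 2-element subsets of vertices (represented as elements of `Sym2`),
with respect to a distance function `d`:
`Min4PC({i,j},{k,l}) = min { d(i,j)+d(k,l), d(i,k)+d(j,l), d(i,l)+d(j,k) }`. -/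
noncomputable def min4PC {V : Type*} (d : V → V → ℕ) (e e' : Sym2 V) : ℕ :=
  min (d e.out.1 e.out.2 + d e'.out.1 e'.out.2)
    (min (d e.out.1 e'.out.1 + d e.out.2 e'.out.2)
      (d e.out.1 e'.out.2 + d e.out.2 e'.out.1))

open Matrix

/-- The Min4PC value of `{a, b}` and `{k, l}` does not depend on how the pairs are ordered. -/
lemma min4PC_mk {V : Type*} (d : V → V → ℕ) (hd : ∀ x y, d x y = d y x) (a b k l : V) :
    min4PC d s(a, b) s(k, l) = min (d a b + d k l) (min (d a k + d b l) (d a l + d b k)) := by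
  have out_cases (x y : V) : s(x, y).out = (x, y) ∨ s(x, y).out = (y, x) := by
    have h : s(s(x, y).out.1, s(x, y).out.2) = s(x, y) := Quot.out_eq _
    generalize s(x, y).out = z at h
    obtain ⟨z₁, z₂⟩ := z
    simpa [Prod.ext_iff] using h
  unfold min4PC
  rcases out_cases a b with h | h <;> rcases out_cases k l with h' | h' <;>
    simp only [h, h', hd b a, hd l k] <;> omega

lemma min4PC_self {V : Type*} (d : V → V → ℕ) (hd : ∀ x, d x x = 0) (e : Sym2 V) :
    min4PC d e e = 0 := by
  simp [min4PC, hd]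

lemma min4PC_comm {V : Type*} (d : V → V → ℕ) (hd : ∀ x y, d x y = d y x) (e e' : Sym2 V) :
    min4PC d e e' = min4PC d e' e := by
  induction e using Sym2.ind with | _ a b =>
  induction e' using Sym2.ind with | _ k l =>
  rw [min4PC_mk d hd, min4PC_mk d hd, hd k a, hd k b, hd l a, hd l b]
  omega

namespace SimpleGraph

variable {V : Type*} {G : SimpleGraph V}

lemma Walk.dist_add_dist_of_mem_support {u v x : V} {p : G.Walk u v}
    (hp : p.length = G.dist u v) (hx : x ∈ p.support) :
    G.dist u x + G.dist x v = G.dist u v := by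
  classical
  have h := congrArg Walk.length (p.take_spec hx)
  rw [Walk.length_append] at h
  have h₁ := G.dist_le (p.takeUntil x hx)
  have h₂ := G.dist_le (p.dropUntil x hx)
  have h₃ : G.dist u v ≤ _ := (p.takeUntil x hx).reachable.dist_triangle_left v
  omega

lemma IsTree.eq_of_isPath (hG : G.IsTree) {u v : V} {p q : G.Walk u v} (hp : p.IsPath)
    (hq : q.IsPath) : p = q :=
  (hG.existsUnique_path u v).unique hp hq

lemma IsTree.length_eq_dist (hG : G.IsTree) {u v : V} {p : G.Walk u v} (hp : p.IsPath) :
    p.length = G.dist u v := by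
  obtain ⟨q, hq, hl⟩ := hG.connected.exists_path_of_dist u v
  rw [hG.eq_of_isPath hp hq, hl]

/-- In a tree, the distances from a vertex to the two ends of an edge differ by one. -/
lemma IsTree.dist_adj (hG : G.IsTree) {k l : V} (h : G.Adj k l) (i : V) :
    G.dist i l = G.dist i k + 1 ∨ G.dist i k = G.dist i l + 1 := by
  obtain ⟨p, hp, hl⟩ := hG.connected.exists_path_of_dist i k
  by_cases hlp : l ∈ p.support
  · have := Walk.dist_add_dist_of_mem_support hl hlp
    rw [dist_eq_one_iff_adj.mpr h.symm] at this
    exact Or.inr this.symm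
  · left
    rw [← hG.length_eq_dist (hp.concat hlp h), Walk.length_concat, hl]

/-- If `i` lies on the `k`-side and `j` on the `l`-side of an edge `kl` of a tree, the path from
`i` to `j` traverses that edge. -/
lemma IsTree.mem_edges_of_dist (hG : G.IsTree) {i j k l : V} (h : G.Adj k l)
    (hi : G.dist i l = G.dist i k + 1) (hj : G.dist j k = G.dist j l + 1)
    {p : G.Walk i j} (hp : p.IsPath) :
    s(k, l) ∈ p.edges ∧ G.dist i j = G.dist i k + 1 + G.dist j l := by
  obtain ⟨q, hq, hql⟩ := hG.connected.exists_path_of_dist i k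
  obtain ⟨r, hr, hrl⟩ := hG.connected.exists_path_of_dist l j
  have hpath : (q.append (Walk.cons h r)).IsPath := by
    refine Walk.IsPath.mk' ?_
    rw [Walk.support_append, Walk.support_cons, List.tail_cons, List.nodup_append]
    refine ⟨hq.support_nodup, hr.support_nodup, ?_⟩
    rintro v hvq _ hvr rfl
    have h₁ := Walk.dist_add_dist_of_mem_support hql hvq
    have h₂ := Walk.dist_add_dist_of_mem_support hrl hvr
    have h₃ : G.dist i l ≤ G.dist i v + G.dist v l := hG.connected.dist_triangle
    have h₄ : G.dist k j ≤ G.dist k v + G.dist v j := hG.connected.dist_triangle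
    rw [G.dist_comm (u := k) (v := j), G.dist_comm (u := k) (v := v)] at h₄
    rw [G.dist_comm (u := l) (v := j), G.dist_comm (u := l) (v := v)] at h₂
    omega
  constructor
  · rw [hG.eq_of_isPath hp hpath]
    simp
  · rw [← hG.length_eq_dist hpath, Walk.length_append, Walk.length_cons, hql, hrl,
      G.dist_comm (u := l)]
    omega

/-- The Min4PC value of a pair of vertices of a tree and an edge depends only on whether the edge
lies on the path joining the pair. -/
lemma IsTree.min4PC_edge [DecidableEq V] (hG : G.IsTree) {i j : V} {p : G.Walk i j}
    (hp : p.IsPath) {e : Sym2 V} (he : e ∈ G.edgeSet) :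
    min4PC G.dist s(i, j) e =
      if e ∈ p.edges then G.dist i j - 1 else G.dist i j + 1 := by
  induction e using Sym2.ind with | _ k l =>
  have h : G.Adj k l := he
  rw [min4PC_mk G.dist (fun _ _ => G.dist_comm), dist_eq_one_iff_adj.mpr h]
  have hik := hG.dist_adj h i
  have hjk := hG.dist_adj h j
  have tri (x : V) : G.dist i j ≤ G.dist i x + G.dist j x := by
    rw [G.dist_comm (u := j)]
    exact hG.connected.dist_triangle
  have hk := tri k
  have hl := tri l
  split_ifs with hmem
  · have hk' := Walk.dist_add_dist_of_mem_support (hG.length_eq_dist hp)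
      (p.fst_mem_support_of_mem_edges hmem)
    have hl' := Walk.dist_add_dist_of_mem_support (hG.length_eq_dist hp)
      (p.snd_mem_support_of_mem_edges hmem)
    rw [G.dist_comm (v := j)] at hk' hl'
    omega
  · have h₁ : ¬(G.dist i l = G.dist i k + 1 ∧ G.dist j k = G.dist j l + 1) := fun hc =>
      hmem (hG.mem_edges_of_dist h hc.1 hc.2 hp).1
    have h₂ : ¬(G.dist i k = G.dist i l + 1 ∧ G.dist j l = G.dist j k + 1) := fun hc =>
      hmem (Sym2.eq_swap ▸ (hG.mem_edges_of_dist h.symm hc.1 hc.2 hp).1)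
    omega

lemma IsTree.min4PC_edge_edge (hG : G.IsTree) {e e' : Sym2 V} (he : e ∈ G.edgeSet)
    (he' : e' ∈ G.edgeSet) (hne : e ≠ e') : min4PC G.dist e e' = 2 := by
  classical
  induction e using Sym2.ind with | _ a b =>
  have h : G.Adj a b := he
  rw [hG.min4PC_edge (Walk.IsPath.of_adj h) he', if_neg (by simpa using hne.symm),
    dist_eq_one_iff_adj.mpr h]

end SimpleGraph

/-- The characteristic polynomial of `2ppᵀ + uwᵀ + wuᵀ + 2wwᵀ - 2I` for `w` a unit vector
orthogonal to `p` and `u`. -/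
lemma charpoly_bordered {n : ℕ} (hn : 3 ≤ n) (p u w : Fin n → ℝ)
    (hpw : p ⬝ᵥ w = 0) (huw : u ⬝ᵥ w = 0) (hww : w ⬝ᵥ w = 1) :
    ((2 : ℝ) • vecMulVec p p + vecMulVec u w + vecMulVec w u + (2 : ℝ) • vecMulVec w w
        - scalar (Fin n) (2 : ℝ)).charpoly =
      (X + C 2) ^ (n - 3) *
        (X * (X + C 2) * (X + C 2 - C (2 * (p ⬝ᵥ p))) - C (u ⬝ᵥ u) * (X + C 2 - C (2 * (p ⬝ᵥ p)))
          - C (2 * (p ⬝ᵥ u) ^ 2)) := by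
  let U : Matrix (Fin n) (Fin 3) ℝ := (of ![p, u, w])ᵀ
  let W : Matrix (Fin 3) (Fin n) ℝ := of ![(2 : ℝ) • p, w, u + (2 : ℝ) • w]
  have hUW : (2 : ℝ) • vecMulVec p p + vecMulVec u w + vecMulVec w u + (2 : ℝ) • vecMulVec w w = U * W := by
    ext k l
    simp [U, W, Matrix.mul_apply, Fin.sum_univ_three, vecMulVec_apply]
    ring
  have hWU : W * U = !![2 * (p ⬝ᵥ p), 2 * (p ⬝ᵥ u), 0; 0, 0, 1; p ⬝ᵥ u, u ⬝ᵥ u, 2] := by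
    have hentry (a c : Fin 3) : (W * U) a c =
        (![(2 : ℝ) • p, w, u + (2 : ℝ) • w] a) ⬝ᵥ (![p, u, w] c) := rfl
    ext a c
    rw [hentry]
    fin_cases a <;> fin_cases c <;>
      simp [hpw, huw, hww, dotProduct_comm w, dotProduct_comm u p, add_dotProduct]
  rw [charpoly_sub_scalar, hUW, charpoly_mul_comm_of_le _ _ (by simpa using hn), hWU,
    mul_comp, pow_comp, X_comp, Fintype.card_fin, Fintype.card_fin]
  congr 1
  rw [Matrix.charpoly, det_fin_three]
  simp
  ring

/-- Let `T` be a tree on `n ≥ 3` vertices, `E` its edge set and `f = {i,j}` a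
non-edge of `T` with `d(i,j) = d > 1`.  Then the characteristic polynomial of the `n × n` matrix
`Min4PC_T[B,B]` with `B = E ∪ {f}` factors as `(x+2)^(n-3) * g(x)` where
`g(x) = x³ - (2n-6)x² - (nd² - 5d² + 2nd - 2d + 5n - 9)x - 2(d-1)²(n-1)`;
equivalently the eigenvalues of `Min4PC_T[B,B]` are `-2` with multiplicity `n-3` together with
the three roots of `g`. -/
theorem charpoly_min4PC_basis
    (n : ℕ) (hn : 3 ≤ n) (T : SimpleGraph (Fin n)) (hT : T.IsTree)
    (i j : Fin n) (d : ℕ) (hd : T.dist i j = d) (hd1 : 1 < d)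
    (f : Sym2 (Fin n)) (hf : f = s(i, j)) (hf_nonedge : f ∉ T.edgeSet)
    (b : Fin n → Sym2 (Fin n)) (hb_inj : Function.Injective b)
    (hb_range : Set.range b = T.edgeSet ∪ {f})
    (N : Matrix (Fin n) (Fin n) ℝ)
    (hN : N = Matrix.of fun k l => (min4PC T.dist (b k) (b l) : ℝ)) :
    N.charpoly = (X + C 2) ^ (n - 3) *
      (X ^ 3 - C (2 * (n : ℝ) - 6) * X ^ 2
        - C ((n : ℝ) * (d : ℝ) ^ 2 - 5 * (d : ℝ) ^ 2 + 2 * (n : ℝ) * (d : ℝ)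
              - 2 * (d : ℝ) + 5 * (n : ℝ) - 9) * X
        - C (2 * ((d : ℝ) - 1) ^ 2 * ((n : ℝ) - 1))) := by
  classical
  subst hf hN
  have hsymm : ∀ x y, T.dist x y = T.dist y x := fun _ _ => T.dist_comm
  obtain ⟨p, hp, hpl⟩ := hT.connected.exists_path_of_dist i j
  obtain ⟨k₀, hk₀⟩ : ∃ k, b k = s(i, j) := by
    have : s(i, j) ∈ Set.range b := hb_range ▸ Or.inr rfl
    exact this
  have hk₀_iff (k : Fin n) : b k = s(i, j) ↔ k = k₀ := by rw [← hk₀, hb_inj.eq_iff]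
  have hedge {k : Fin n} (hk : k ≠ k₀) : b k ∈ T.edgeSet := by
    have : b k ∈ T.edgeSet ∪ {s(i, j)} := hb_range ▸ Set.mem_range_self k
    exact this.resolve_right fun h => hk ((hk₀_iff k).mp h)
  have hk₀p : b k₀ ∉ p.edges := fun h => hf_nonedge (hk₀ ▸ p.edges_subset_edgeSet h)
  let w : Fin n → ℝ := fun k => if k = k₀ then 1 else 0
  let q : Fin n → ℝ := fun k => if b k ∈ p.edges then 1 else 0
  let u : Fin n → ℝ := fun k => (d + 1) * (1 - w k) - 2 * q k
  have hq : ∑ k, q k = d := by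
    have himage : Finset.image b {k | b k ∈ p.edges} = p.edges.toFinset := by
      ext e
      simp only [Finset.mem_image, Finset.mem_filter, Finset.mem_univ, true_and,
        List.mem_toFinset]
      refine ⟨by rintro ⟨k, hk, rfl⟩; exact hk, fun he => ?_⟩
      have : e ∈ Set.range b := hb_range ▸ Or.inl (p.edges_subset_edgeSet he)
      obtain ⟨k, rfl⟩ := this
      exact ⟨k, he, rfl⟩
    simp only [q, Finset.sum_boole]
    rw [← Finset.card_image_of_injective _ hb_inj, himage,
      List.toFinset_card_of_nodup hp.isTrail.edges_nodup, p.length_edges, hpl, hd]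
  have hw : ∑ k, w k = 1 := by simp [w]
  have hww (k : Fin n) : w k * w k = w k := by simp [w]
  have hqq (k : Fin n) : q k * q k = q k := by simp [q]
  have hwq (k : Fin n) : w k * q k = 0 := by
    by_cases hk : k = k₀ <;> simp [w, q, hk, hk₀p]
  have hmat : (Matrix.of fun k l => (min4PC T.dist (b k) (b l) : ℝ)) =
      (2 : ℝ) • vecMulVec (1 - w) (1 - w) + vecMulVec u w + vecMulVec w u + (2 : ℝ) • vecMulVec w w
        - scalar (Fin n) (2 : ℝ) := by
    have hborder {k : Fin n} (hk : k ≠ k₀) : (min4PC T.dist s(i, j) (b k) : ℝ) = u k := by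
      rw [hT.min4PC_edge hp (hedge hk), hd]
      by_cases hmem : b k ∈ p.edges
      · simp [u, w, q, hk, hmem, Nat.cast_sub hd1.le]
        ring
      · simp [u, w, q, hk, hmem]
    have hu₀ : u k₀ = 0 := by simp [u, w, q, hk₀p]
    ext k l
    by_cases hkl : k = l
    · subst hkl
      by_cases hk : k = k₀
      · simp [min4PC_self, vecMulVec_apply, w, hk, hu₀]
      · simp [min4PC_self, vecMulVec_apply, w, hk]
    by_cases hk : k = k₀
    · subst hk
      have hl : l ≠ k := Ne.symm hkl
      simp [hk₀, hborder hl, vecMulVec_apply, w, hl, hkl]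
    by_cases hl : l = k₀
    · subst hl
      simp [hk₀, min4PC_comm T.dist hsymm (b k), hborder hk, vecMulVec_apply, w, hk]
    · simp [hT.min4PC_edge_edge (hedge hk) (hedge hl) (hb_inj.ne hkl), vecMulVec_apply, w, hk, hl,
        hkl]
  have sum_eq (v : Fin n → ℝ) (α β γ : ℝ) (hv : ∀ k, v k = α + β * w k + γ * q k) :
      ∑ k, v k = n * α + β + γ * d := by
    simp [hv, Finset.sum_add_distrib, ← Finset.mul_sum, hw, hq]
  have hpp : (1 - w) ⬝ᵥ (1 - w) = (n - 1 : ℝ) := by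
    rw [dotProduct, sum_eq _ 1 (-1) 0 fun k => by
      simp only [Pi.sub_apply, Pi.one_apply]; linear_combination hww k]
    ring
  have hpu : (1 - w) ⬝ᵥ u = (d + 1) * (n - 1) - 2 * d := by
    rw [dotProduct, sum_eq _ (d + 1) (-(d + 1)) (-2) fun k => by
      simp only [Pi.sub_apply, Pi.one_apply, u]
      linear_combination (d + 1) * hww k + 2 * hwq k]
    ring
  have huu : u ⬝ᵥ u = (d + 1) ^ 2 * (n - 1) - 4 * d ^ 2 := by
    rw [dotProduct, sum_eq _ ((d + 1) ^ 2) (-(d + 1) ^ 2) (-4 * d) fun k => by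
      simp only [u]
      linear_combination (d + 1) ^ 2 * hww k + 4 * hqq k + 4 * (d + 1) * hwq k]
    ring
  rw [hmat, charpoly_bordered hn _ _ _ ?_ ?_ ?_, hpp, hpu, huu]
  · simp only [map_sub, map_add, map_mul, map_pow, map_one, map_natCast, map_ofNat]
    ring
  · rw [dotProduct, sum_eq _ 0 0 0 fun k => by
      simp only [Pi.sub_apply, Pi.one_apply]; linear_combination -hww k]
    ring
  · rw [dotProduct, sum_eq _ 0 0 0 fun k => by
      simp only [u]; linear_combination -(d + 1) * hww k - 2 * hwq k]
    ring
  · simp only [dotProduct, hww, hw]
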